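/- arXiv:2601.19370 — 8 statements merged into one kernel-verified Lean document; each statement's English description precedes it below -/
import Mathlib

section
/- Let r, a, m, λ_P > 0 and let s be a real number with s ≠ 1. Then 2 λ_P ( ∫₀^{r+a} e^{m Ā(r,a,x)(s−1)} dx − (r+a) ) = 2 λ_P [ |r−a| e^{m β̄(r)(s−1)} − (r+a) + (e^{m β̄(r)(s−1)} − 1) / ((m/(2a))(s−1)) ]. -/
open MeasureTheory Real intervalIntegral

/-- `A r a x` : length of the intersection of two 1D intervals of radii `r` and `a`
whose centers are at distance `x`. -/
noncomputable def interLen (r a x : ℝ) : ℝ :=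
  if x ≤ |r - a| then 2 * min r a else if x ≤ r + a then r + a - x else 0

/-- Closed form of the exponent `g(s,r)` of the PGF of the number of points of a
1D Matérn cluster process in an interval of radius `r`. -/
theorem g_closed_form (r a m lamP s : ℝ) (hr : 0 < r) (ha : 0 < a) (hm : 0 < m)
    (hlamP : 0 < lamP) (hs : s ≠ 1) :
    2 * lamP * ((∫ x in (0:ℝ)..(r + a),
        Real.exp (m * (interLen r a x / (2 * a)) * (s - 1))) - (r + a))
      = 2 * lamP * (|r - a| * Real.exp (m * (min r a / a) * (s - 1)) - (r + a)
          + (Real.exp (m * (min r a / a) * (s - 1)) - 1) / ((m / (2 * a)) * (s - 1))) := by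
  have hc0 : 0 ≤ |r - a| := abs_nonneg _
  have hmin : 2 * min r a = r + a - |r - a| := by
    rcases le_total r a with h | h
    · rw [min_eq_left h, abs_of_nonpos (by linarith)]; ring
    · rw [min_eq_right h, abs_of_nonneg (by linarith)]; ring
  have hcle : |r - a| ≤ r + a := by
    have : 0 < min r a := lt_min hr ha
    linarith
  obtain ⟨k, hk⟩ : ∃ k, k = m / (2 * a) * (s - 1) := ⟨_, rfl⟩
  have hk0 : k ≠ 0 := by
    rw [hk]
    exact mul_ne_zero (by positivity) (sub_ne_zero.mpr hs)
  have hE : m * (min r a / a) * (s - 1) = k * (r + a - |r - a|) := by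
    rw [hk, ← hmin]; field_simp
  have e1 : Set.EqOn (fun _ : ℝ => Real.exp (k * (r + a - |r - a|)))
      (fun x => Real.exp (m * (interLen r a x / (2 * a)) * (s - 1)))
      (Set.uIoc 0 |r - a|) := by
    intro x hx
    rw [Set.uIoc_of_le hc0] at hx
    simp only [interLen, if_pos hx.2]
    rw [hmin, hk]
    congr 1
    ring
  have e2 : Set.EqOn (fun x : ℝ => Real.exp (k * (r + a - x)))
      (fun x => Real.exp (m * (interLen r a x / (2 * a)) * (s - 1)))
      (Set.uIoc |r - a| (r + a)) := by
    intro x hx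
    rw [Set.uIoc_of_le hcle] at hx
    simp only [interLen, if_neg (not_le.mpr hx.1), if_pos hx.2]
    rw [hk]
    congr 1
    ring
  have c2 : Continuous (fun x : ℝ => Real.exp (k * (r + a - x))) := by fun_prop
  have i1 : IntervalIntegrable (fun x => Real.exp (m * (interLen r a x / (2 * a)) * (s - 1)))
      volume 0 |r - a| :=
    (intervalIntegrable_const).congr e1
  have i2 : IntervalIntegrable (fun x => Real.exp (m * (interLen r a x / (2 * a)) * (s - 1)))
      volume |r - a| (r + a) :=
    (c2.intervalIntegrable _ _).congr e2
  have v1 : ∫ x in (0:ℝ)..|r - a|, Real.exp (m * (interLen r a x / (2 * a)) * (s - 1))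
      = |r - a| * Real.exp (k * (r + a - |r - a|)) := by
    rw [← intervalIntegral.integral_congr_ae (Filter.Eventually.of_forall e1)]
    simp
  have v2 : ∫ x in |r - a|..(r + a), Real.exp (m * (interLen r a x / (2 * a)) * (s - 1))
      = (Real.exp (k * (r + a - |r - a|)) - 1) / k := by
    rw [← intervalIntegral.integral_congr_ae (Filter.Eventually.of_forall e2)]
    rw [intervalIntegral.integral_eq_sub_of_hasDerivAt
      (f := fun x => - Real.exp (k * (r + a - x)) / k) (fun x _ => ?_)
      (c2.intervalIntegrable _ _)]
    · simp only [sub_self, mul_zero, Real.exp_zero]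
      ring
    · have h := (((((hasDerivAt_id x).const_sub (r + a)).const_mul k).exp).neg).div_const k
      have h2 : HasDerivAt (fun x => - Real.exp (k * (r + a - x)) / k)
          (-(Real.exp (k * (r + a - x)) * (k * -1)) / k) x := h
      refine h2.congr_deriv ?_
      field_simp
  rw [← intervalIntegral.integral_add_adjacent_intervals i1 i2, v1, v2, hE, ← hk]
  ring
end

section
/- Let λ, λ_r > 0, set γ = λ/λ_r, and let p(k) = 4 λ_r² λ^k (k+1) / (λ + 2 λ_r)^{k+2} for integers k ≥ 0. Then Σ_{k≥0} k·p(k) = γ and Σ_{k≥0} k²·p(k) − γ² = γ²/2 + γ; that is, the load on the typical RSU in the non-platooned scenario has mean γ and variance γ²/2 + γ. -/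
open MeasureTheory Real

/-- Mean and variance of the load on the typical RSU in the non-platooned scenario:
with `γ = λ/λ_r` and `p(k) = 4 λ_r² λ^k (k+1)/(λ+2λ_r)^{k+2}`, the mean is `γ` and the
variance is `γ²/2 + γ`. -/
theorem mean_var_typical_load_npts (lam lamr : ℝ) (hlam : 0 < lam) (hlamr : 0 < lamr) :
    (∑' k : ℕ, (k : ℝ) * (4 * lamr ^ 2 * lam ^ k * ((k : ℝ) + 1) / (lam + 2 * lamr) ^ (k + 2)))
        = lam / lamr
      ∧ (∑' k : ℕ, (k : ℝ) ^ 2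
            * (4 * lamr ^ 2 * lam ^ k * ((k : ℝ) + 1) / (lam + 2 * lamr) ^ (k + 2)))
          - (lam / lamr) ^ 2
        = (lam / lamr) ^ 2 / 2 + lam / lamr := by
  have hL : 0 < lam + 2 * lamr := by positivity
  have hr : ‖lam / (lam + 2 * lamr)‖ < 1 := by
    rw [Real.norm_of_nonneg (by positivity), div_lt_one hL]
    linarith
  have h1r : 1 - lam / (lam + 2 * lamr) = 2 * lamr / (lam + 2 * lamr) := by
    field_simp
    ring
  have h1 := hasSum_choose_mul_geometric_of_norm_lt_one 1 hr
  have h2 := hasSum_choose_mul_geometric_of_norm_lt_one 2 hr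
  have h3 := hasSum_choose_mul_geometric_of_norm_lt_one 3 hr
  rw [h1r] at h1 h2 h3
  have c1 : ∀ k : ℕ, (((k + 1).choose 1 : ℕ) : ℝ) = (k : ℝ) + 1 := by
    intro k
    simp
  have c2 : ∀ k : ℕ, (((k + 2).choose 2 : ℕ) : ℝ) = ((k : ℝ) + 1) * (k + 2) / 2 := by
    intro k
    rw [Nat.cast_choose_two]
    push_cast
    ring
  have c3 : ∀ k : ℕ, (((k + 3).choose 3 : ℕ) : ℝ) = ((k : ℝ) + 1) * (k + 2) * (k + 3) / 6 := by
    intro k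
    have h := Nat.add_one_mul_choose_eq (k + 2) 2
    have h' : ((k : ℝ) + 2 + 1) * (((k + 2).choose 2 : ℕ) : ℝ)
        = (((k + 3).choose 3 : ℕ) : ℝ) * (2 + 1) := by exact_mod_cast h
    rw [c2] at h'
    linarith
  have e1 := ((h2.mul_left 2).sub (h1.mul_left 2)).mul_left (4 * lamr ^ 2 / (lam + 2 * lamr) ^ 2)
  have e2 := (((h3.mul_left 6).sub (h2.mul_left 10)).add (h1.mul_left 4)).mul_left
    (4 * lamr ^ 2 / (lam + 2 * lamr) ^ 2)
  constructor
  · refine Eq.trans (Eq.trans (tsum_congr fun k => ?_) e1.tsum_eq) ?_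
    · rw [c1, c2, div_pow, pow_add]
      field_simp
      ring
    · simp only [div_pow, one_div_div]
      field_simp
      ring
  · rw [sub_eq_iff_eq_add]
    refine Eq.trans (Eq.trans (tsum_congr fun k => ?_) e2.tsum_eq) ?_
    · rw [c1, c2, c3, div_pow, pow_add]
      field_simp
      ring
    · simp only [div_pow, one_div_div]
      field_simp
      ring
end

section
/- Let λ, λ_r > 0, set γ = λ/λ_r, and let p(k) = 4 λ_r² λ^k (k+1) / (λ + 2 λ_r)^{k+2} for integers k ≥ 0. Then the third central moment satisfies Σ_{k≥0} (k − γ)³ p(k) = γ³/2 + 3γ²/2 + γ, and consequently the skewness equals (γ³/2 + 3γ²/2 + γ) / (γ²/2 + γ)^{3/2}. -/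
open MeasureTheory Real

theorem choose_succ_cast (m k : ℕ) :
    (((m + 1).choose (k + 1) : ℕ) : ℝ) = ((m : ℝ) + 1) * (m.choose k : ℝ) / ((k : ℝ) + 1) := by
  have h := Nat.add_one_mul_choose_eq m k
  have h' : ((m : ℝ) + 1) * (m.choose k : ℝ) = ((m + 1).choose (k + 1) : ℝ) * ((k : ℝ) + 1) := by
    exact_mod_cast h
  rw [h']
  field_simp

theorem third_moment_hasSum (lam lamr : ℝ) (hlam : 0 < lam) (hlamr : 0 < lamr) :
    HasSum (fun k : ℕ => ((k : ℝ) - lam / lamr) ^ 3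
        * (4 * lamr ^ 2 * lam ^ k * ((k : ℝ) + 1) / (lam + 2 * lamr) ^ (k + 2)))
      ((lam / lamr) ^ 3 / 2 + 3 * (lam / lamr) ^ 2 / 2 + lam / lamr) := by
  have hs : 0 < lam + 2 * lamr := by positivity
  have hq : ‖lam / (lam + 2 * lamr)‖ < 1 := by
    rw [Real.norm_of_nonneg (by positivity), div_lt_one hs]
    linarith
  have H := fun j => hasSum_choose_mul_geometric_of_norm_lt_one (𝕜 := ℝ) j hq
  have hT := ((((H 1).mul_left (-(2 + lam / lamr) ^ 3)).add
    ((H 2).mul_left (2 * ((3 + lam / lamr) ^ 3 - (2 + lam / lamr) ^ 3)))).add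
    (((H 3).mul_left (6 * (-3 * (3 + lam / lamr)))).add
    ((H 4).mul_left 24))).mul_left (4 * lamr ^ 2 / (lam + 2 * lamr) ^ 2)
  convert hT using 1
  · rfl
  · funext k
    have c1 : (((k + 1).choose 1 : ℕ) : ℝ) = k + 1 := by simp
    have c2 : (((k + 2).choose 2 : ℕ) : ℝ) = (k + 2) * (k + 1) / 2 := by
      have := choose_succ_cast (k + 1) 1
      rw [c1] at this
      rw [this]; push_cast; ring
    have c3 : (((k + 3).choose 3 : ℕ) : ℝ) = (k + 3) * (k + 2) * (k + 1) / 6 := by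
      have := choose_succ_cast (k + 2) 2
      rw [c2] at this
      rw [this]; push_cast; ring
    have c4 : (((k + 4).choose 4 : ℕ) : ℝ) = (k + 4) * (k + 3) * (k + 2) * (k + 1) / 24 := by
      have := choose_succ_cast (k + 3) 3
      rw [c3] at this
      rw [this]; push_cast; ring
    rw [c1, c2, c3, c4, div_pow lam, pow_add]
    generalize lam / lamr = g
    field_simp
    ring
  · have h1 : 1 - lam / (lam + 2 * lamr) = 2 * lamr / (lam + 2 * lamr) := by
      field_simp
      ring
    rw [h1]
    simp only [div_pow (2 * lamr) (lam + 2 * lamr), one_div_div]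
    field_simp
    ring

/-- Third central moment and skewness of the load on the typical RSU in the non-platooned
scenario: with `γ = λ/λ_r` and `p(k) = 4 λ_r² λ^k (k+1)/(λ+2λ_r)^{k+2}`, the third central
moment is `γ³/2 + 3γ²/2 + γ`, and the skewness (third central moment divided by
`Var^{3/2}`, with `Var = γ²/2 + γ`) equals `(γ³/2 + 3γ²/2 + γ)/(γ²/2 + γ)^{3/2}`. -/
theorem skewness_typical_load_npts (lam lamr : ℝ) (hlam : 0 < lam) (hlamr : 0 < lamr) :
    (∑' k : ℕ, ((k : ℝ) - lam / lamr) ^ 3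
        * (4 * lamr ^ 2 * lam ^ k * ((k : ℝ) + 1) / (lam + 2 * lamr) ^ (k + 2)))
      = (lam / lamr) ^ 3 / 2 + 3 * (lam / lamr) ^ 2 / 2 + lam / lamr
    ∧ (∑' k : ℕ, ((k : ℝ) - lam / lamr) ^ 3
          * (4 * lamr ^ 2 * lam ^ k * ((k : ℝ) + 1) / (lam + 2 * lamr) ^ (k + 2)))
        / ((lam / lamr) ^ 2 / 2 + lam / lamr) ^ ((3 : ℝ) / 2)
      = ((lam / lamr) ^ 3 / 2 + 3 * (lam / lamr) ^ 2 / 2 + lam / lamr)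
          / ((lam / lamr) ^ 2 / 2 + lam / lamr) ^ ((3 : ℝ) / 2) := by
  have h := (third_moment_hasSum lam lamr hlam hlamr).tsum_eq
  exact ⟨h, by rw [h]⟩
end

section
/- Let λ, λ_r > 0, set γ = λ/λ_r, and let k ≥ 0 be an integer. Then ∫₀^∞ ((λ l)^k e^{−λ l}/k!) · f_{L_o}(l) dl = (γ/2)^k · ((k+2)(k+1)/2) / (1 + γ/2)^{3+k}, which equals 4 λ_r³ λ^k (k+1)(k+2) / (λ + 2λ_r)^{k+3}. -/
open MeasureTheory Real

/-- PMF of the load on the tagged RSU in the non-platooned scenario: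
`∫₀^∞ ((λl)^k e^{−λl}/k!) f_{L_o}(l) dl = (γ/2)^k ((k+2)(k+1)/2)/(1+γ/2)^{3+k}`
with `γ = λ/λ_r`, which equals `4 λ_r³ λ^k (k+1)(k+2)/(λ+2λ_r)^{k+3}`. -/
theorem pmf_tagged_load_npts (lam lamr : ℝ) (k : ℕ) (hlam : 0 < lam) (hlamr : 0 < lamr) :
    (∫ l in Set.Ioi (0 : ℝ),
        ((lam * l) ^ k * Real.exp (-(lam * l)) / (Nat.factorial k : ℝ))
          * (4 * lamr ^ 3 * l ^ 2 * Real.exp (-2 * lamr * l)))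
      = (lam / lamr / 2) ^ k * (((k : ℝ) + 2) * ((k : ℝ) + 1) / 2)
          / (1 + lam / lamr / 2) ^ (3 + k)
    ∧ (lam / lamr / 2) ^ k * (((k : ℝ) + 2) * ((k : ℝ) + 1) / 2)
          / (1 + lam / lamr / 2) ^ (3 + k)
      = 4 * lamr ^ 3 * lam ^ k * ((k : ℝ) + 1) * ((k : ℝ) + 2) / (lam + 2 * lamr) ^ (k + 3) := by
  have h2 : (lam / lamr / 2) ^ k * (((k : ℝ) + 2) * ((k : ℝ) + 1) / 2)
          / (1 + lam / lamr / 2) ^ (3 + k)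
      = 4 * lamr ^ 3 * lam ^ k * ((k : ℝ) + 1) * ((k : ℝ) + 2)
          / (lam + 2 * lamr) ^ (k + 3) := by
    have e1 : 1 + lam / lamr / 2 = (lam + 2 * lamr) / (2 * lamr) := by
      field_simp
      ring
    have e2 : lam / lamr / 2 = lam / (2 * lamr) := by
      field_simp
    have hs : lam + 2 * lamr ≠ 0 := by positivity
    have ht : 2 * lamr ≠ 0 := by positivity
    rw [e1, e2, add_comm 3 k, div_pow, div_pow]
    have e3 : 4 * lamr ^ 3 = (2 * lamr) ^ 3 / 2 := by ring
    rw [e3]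
    generalize lam + 2 * lamr = s at hs ⊢
    generalize 2 * lamr = t at ht ⊢
    rw [pow_add t]
    field_simp
  refine ⟨?_, h2⟩
  rw [h2]
  have key := Real.integral_rpow_mul_exp_neg_mul_Ioi
    (a := ((k + 2 : ℕ) : ℝ) + 1) (r := lam + 2 * lamr) (by positivity) (by positivity)
  rw [Real.Gamma_nat_eq_factorial, add_sub_cancel_right] at key
  have e4 : (∫ l in Set.Ioi (0 : ℝ),
        ((lam * l) ^ k * Real.exp (-(lam * l)) / (Nat.factorial k : ℝ))
          * (4 * lamr ^ 3 * l ^ 2 * Real.exp (-2 * lamr * l)))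
      = ∫ l in Set.Ioi (0 : ℝ), (4 * lamr ^ 3 * lam ^ k / (Nat.factorial k : ℝ)) *
          (l ^ ((k + 2 : ℕ) : ℝ) * Real.exp (-((lam + 2 * lamr) * l))) := by
    congr 1
    funext l
    have : Real.exp (-((lam + 2 * lamr) * l))
        = Real.exp (-(lam * l)) * Real.exp (-2 * lamr * l) := by
      rw [← Real.exp_add]
      congr 1
      ring
    rw [this, Real.rpow_natCast, mul_pow, pow_add]
    ring
  rw [e4, integral_const_mul, key]
  have e5 : (1 / (lam + 2 * lamr)) ^ (((k + 2 : ℕ) : ℝ) + 1)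
      = 1 / (lam + 2 * lamr) ^ (k + 3) := by
    rw [← Nat.cast_add_one, Real.rpow_natCast, div_pow, one_pow]
  have hf : (Nat.factorial k : ℝ) ≠ 0 := by positivity
  have hs : lam + 2 * lamr ≠ 0 := by positivity
  rw [e5, Nat.factorial_succ, Nat.factorial_succ]
  push_cast
  field_simp
  ring
end

section
/- Let λ, λ_r > 0, set γ = λ/λ_r, and let q(k) = 4 λ_r³ λ^k (k+1)(k+2) / (λ + 2λ_r)^{k+3} for integers k ≥ 0. Then Σ_{k≥0} k·q(k) = 1.5 γ, Σ_{k≥0} k²·q(k) − (1.5 γ)² = 3(γ/2)² + 1.5 γ, and Σ_{k≥0} k³·q(k) = 7.5 γ³ + 9 γ² + 1.5 γ; that is, the tagged-RSU load in the non-platooned scenario has mean 1.5γ, variance 3(γ/2)² + 1.5γ, and third moment 7.5γ³ + 9γ² + 1.5γ. -/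
open MeasureTheory Real

lemma aux_hasSum (j : ℕ) {r : ℝ} (hr : ‖r‖ < 1) :
    HasSum (fun k : ℕ => (((k + 1).ascFactorial j : ℕ) : ℝ) * r ^ k)
      ((j.factorial : ℝ) * (1 / (1 - r) ^ (j + 1))) := by
  have h := (hasSum_choose_mul_geometric_of_norm_lt_one j hr).mul_left (j.factorial : ℝ)
  refine Eq.mpr (congrArg (fun f => HasSum f _) (funext fun k => ?_)) h
  rw [Nat.ascFactorial_eq_factorial_mul_choose]
  push_cast
  ring

/-- Mean, variance and third moment of the load on the tagged RSU in the non-platooned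
scenario: with `γ = λ/λ_r` and `q(k) = 4 λ_r³ λ^k (k+1)(k+2)/(λ+2λ_r)^{k+3}`, the mean is
`1.5γ`, the variance is `3(γ/2)² + 1.5γ`, and the third moment is `7.5γ³ + 9γ² + 1.5γ`. -/
theorem moments_tagged_load_npts (lam lamr : ℝ) (hlam : 0 < lam) (hlamr : 0 < lamr) :
    (∑' k : ℕ, (k : ℝ)
        * (4 * lamr ^ 3 * lam ^ k * ((k : ℝ) + 1) * ((k : ℝ) + 2) / (lam + 2 * lamr) ^ (k + 3)))
      = 1.5 * (lam / lamr)
    ∧ (∑' k : ℕ, (k : ℝ) ^ 2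
          * (4 * lamr ^ 3 * lam ^ k * ((k : ℝ) + 1) * ((k : ℝ) + 2) / (lam + 2 * lamr) ^ (k + 3)))
        - (1.5 * (lam / lamr)) ^ 2
      = 3 * (lam / lamr / 2) ^ 2 + 1.5 * (lam / lamr)
    ∧ (∑' k : ℕ, (k : ℝ) ^ 3
          * (4 * lamr ^ 3 * lam ^ k * ((k : ℝ) + 1) * ((k : ℝ) + 2) / (lam + 2 * lamr) ^ (k + 3)))
      = 7.5 * (lam / lamr) ^ 3 + 9 * (lam / lamr) ^ 2 + 1.5 * (lam / lamr) := by
  have hs : 0 < lam + 2 * lamr := by positivity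
  obtain ⟨r, hrdef⟩ : ∃ r, r = lam / (lam + 2 * lamr) := ⟨_, rfl⟩
  have hr : ‖r‖ < 1 := by
    rw [hrdef, Real.norm_of_nonneg (by positivity), div_lt_one hs]
    linarith
  have h1r : 1 - r = 2 * lamr / (lam + 2 * lamr) := by
    rw [hrdef]; field_simp; ring
  obtain ⟨c, hc⟩ : ∃ c, c = 4 * lamr ^ 3 / (lam + 2 * lamr) ^ 3 := ⟨_, rfl⟩
  have hq : ∀ k : ℕ, 4 * lamr ^ 3 * lam ^ k * ((k : ℝ) + 1) * ((k : ℝ) + 2)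
      / (lam + 2 * lamr) ^ (k + 3) = c * (((k : ℝ) + 1) * ((k : ℝ) + 2) * r ^ k) := by
    intro k
    rw [hc, hrdef, div_pow, pow_add]
    field_simp
  have h2 := aux_hasSum 2 hr
  have h3 := aux_hasSum 3 hr
  have h4 := aux_hasSum 4 hr
  have h5 := aux_hasSum 5 hr
  rw [h1r] at h2 h3 h4 h5
  simp only [hq]
  refine ⟨?_, ?_, ?_⟩
  · have h := (h3.sub (h2.mul_left 3)).mul_left c
    refine ((tsum_congr fun k => ?_).trans h.tsum_eq).trans ?_
    · simp only [Nat.ascFactorial]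
      push_cast
      ring
    rw [hc]
    simp only [Nat.factorial]
    push_cast
    field_simp
    ring
  · have h := ((h4.sub (h3.mul_left 7)).add (h2.mul_left 9)).mul_left c
    rw [(tsum_congr fun k => ?_).trans h.tsum_eq]
    rotate_left
    · simp only [Nat.ascFactorial]
      push_cast
      ring
    rw [hc]
    simp only [Nat.factorial]
    push_cast
    field_simp
    ring
  · have h := (((h5.sub (h4.mul_left 12)).add (h3.mul_left 37)).sub (h2.mul_left 27)).mul_left c
    refine ((tsum_congr fun k => ?_).trans h.tsum_eq).trans ?_
    · simp only [Nat.ascFactorial]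
      push_cast
      ring
    rw [hc]
    simp only [Nat.factorial]
    push_cast
    field_simp
    ring
end

section
/- Let λ, λ_r > 0 and set γ_r = λ_r/λ. Then the active probability of the typical RSU in the non-platooned scenario satisfies 1 − ∫₀^∞ e^{−λ l} f_L(l) dl = (1 + 4 γ_r)/(1 + 2 γ_r)², equivalently 1 − 4λ_r²/(λ + 2λ_r)² = λ(λ + 4λ_r)/(λ + 2λ_r)². -/
open MeasureTheory Real

/-- Active probability of the typical RSU in the non-platooned scenario:
`1 − ∫₀^∞ e^{−λl} f_L(l) dl = (1 + 4γ_r)/(1 + 2γ_r)²` with `γ_r = λ_r/λ`, equivalently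
`1 − 4λ_r²/(λ+2λ_r)² = λ(λ+4λ_r)/(λ+2λ_r)²`. -/
theorem active_prob_typical_npts (lam lamr : ℝ) (hlam : 0 < lam) (hlamr : 0 < lamr) :
    (1 - ∫ l in Set.Ioi (0 : ℝ),
        Real.exp (-(lam * l)) * (4 * lamr ^ 2 * l * Real.exp (-2 * lamr * l)))
      = (1 + 4 * (lamr / lam)) / (1 + 2 * (lamr / lam)) ^ 2
    ∧ 1 - 4 * lamr ^ 2 / (lam + 2 * lamr) ^ 2
      = lam * (lam + 4 * lamr) / (lam + 2 * lamr) ^ 2 := by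
  have hs : 0 < lam + 2 * lamr := by positivity
  have key : (∫ l in Set.Ioi (0 : ℝ),
        Real.exp (-(lam * l)) * (4 * lamr ^ 2 * l * Real.exp (-2 * lamr * l)))
      = 4 * lamr ^ 2 / (lam + 2 * lamr) ^ 2 := by
    have h := Real.integral_rpow_mul_exp_neg_mul_Ioi (a := 2) (r := lam + 2 * lamr) two_pos hs
    have h2 : (∫ l in Set.Ioi (0 : ℝ),
        Real.exp (-(lam * l)) * (4 * lamr ^ 2 * l * Real.exp (-2 * lamr * l)))
        = ∫ l in Set.Ioi (0 : ℝ),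
          4 * lamr ^ 2 * (l ^ ((2 : ℝ) - 1) * Real.exp (-((lam + 2 * lamr) * l))) := by
      refine integral_congr_ae (Filter.Eventually.of_forall fun l => ?_)
      have e : Real.exp (-((lam + 2 * lamr) * l))
          = Real.exp (-(lam * l)) * Real.exp (-2 * lamr * l) := by
        rw [← Real.exp_add]; congr 1; ring
      have e2 : l ^ ((2 : ℝ) - 1) = l := by
        rw [show (2 : ℝ) - 1 = 1 by norm_num, Real.rpow_one]
      simp only [e, e2]
      ring
    rw [h2, integral_const_mul, h, Real.Gamma_two, Real.rpow_two]
    field_simp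
  rw [key]
  constructor
  · have : 0 < 1 + 2 * (lamr / lam) := by positivity
    field_simp
    ring
  · field_simp
    ring
end

section
/- Let a, m, λ_P, λ_r > 0 and define, for real s, g(s,r) = 2 λ_P ( ∫₀^{r+a} e^{m Ā(r,a,x)(s−1)} dx − (r+a) ) and Φ(s) = ∫₀^∞ e^{g(s, t/2)} f_L(t) dt. Then Φ is differentiable at s = 1 and Φ'(1) = m λ_P / λ_r; that is, the mean load on the typical RSU under the platooned traffic scenario equals m λ_P / λ_r. -/
open MeasureTheory Real intervalIntegral

/-- Exponent of the PGF of the number of points of a 1D Matérn cluster process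
(parent intensity `λP`, mean cluster size `m`, cluster radius `a`) in an interval of
radius `r`. -/
noncomputable def gExp (lamP m a s r : ℝ) : ℝ :=
  2 * lamP * ((∫ x in (0:ℝ)..(r + a),
      Real.exp (m * (interLen r a x / (2 * a)) * (s - 1))) - (r + a))

/-- PGF of the load on the typical RSU in the platooned traffic scenario. -/
noncomputable def pgfTypicalPTS (lamP m a lamr s : ℝ) : ℝ :=
  ∫ t in Set.Ioi (0 : ℝ),
    Real.exp (gExp lamP m a s (t / 2)) * (4 * lamr ^ 2 * t * Real.exp (-2 * lamr * t))

noncomputable def cK (m a r x : ℝ) : ℝ := m * (min (2 * min r a) (r + a - x) / (2 * a))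

lemma interLen_eq {r a x : ℝ} (hx : x ≤ r + a) :
    interLen r a x = min (2 * min r a) (r + a - x) := by
  unfold interLen
  rcases le_total r a with h | h
  · rw [abs_of_nonpos (by linarith), min_eq_left h]
    split_ifs with h1
    · rw [min_eq_left (by linarith)]
    · rw [min_eq_right (by linarith)]
  · rw [abs_of_nonneg (by linarith), min_eq_right h]
    split_ifs with h1
    · rw [min_eq_left (by linarith)]
    · rw [min_eq_right (by linarith)]

lemma cK_cont (m a : ℝ) : Continuous (fun p : ℝ × ℝ => cK m a p.1 p.2) := by
  unfold cK
  fun_prop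

lemma cK_cont' (m a r : ℝ) : Continuous (cK m a r) := by
  unfold cK
  fun_prop

lemma cK_nonneg {m a r x : ℝ} (hm : 0 < m) (ha : 0 < a) (hr : 0 < r) (hx : x ≤ r + a) :
    0 ≤ cK m a r x := by
  unfold cK
  have : 0 ≤ min (2 * min r a) (r + a - x) := le_min (by positivity) (by linarith)
  positivity

lemma cK_le {m a r x : ℝ} (hm : 0 < m) (ha : 0 < a) : cK m a r x ≤ m := by
  unfold cK
  have h : min (2 * min r a) (r + a - x) ≤ 2 * a :=
    (min_le_left _ _).trans (by linarith [min_le_right r a])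
  have h2 : min (2 * min r a) (r + a - x) / (2 * a) ≤ 1 := by
    rw [div_le_one (by positivity)]; exact h
  nlinarith

lemma integral_cK {m a r : ℝ} (ha : 0 < a) (hr : 0 < r) :
    ∫ x in (0:ℝ)..(r + a), cK m a r x = m * r := by
  have hc : Continuous (cK m a r) := cK_cont' m a r
  have hle : |r - a| ≤ r + a := by rw [abs_le]; constructor <;> linarith
  have habs : |r - a| = r + a - 2 * min r a := by
    rcases le_total r a with h | h
    · rw [abs_of_nonpos (by linarith), min_eq_left h]; ring
    · rw [abs_of_nonneg (by linarith), min_eq_right h]; ring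
  rw [← integral_add_adjacent_intervals (hc.intervalIntegrable 0 |r - a|)
    (hc.intervalIntegrable |r - a| (r + a))]
  have e1 : ∫ x in (0:ℝ)..|r - a|, cK m a r x
      = ∫ x in (0:ℝ)..|r - a|, m * (2 * min r a / (2 * a)) := by
    apply integral_congr
    intro x hx
    rw [Set.uIcc_of_le (abs_nonneg _)] at hx
    simp only [cK]
    rw [min_eq_left (by linarith [hx.2])]
  have e2 : ∫ x in |r - a|..(r + a), cK m a r x
      = ∫ x in |r - a|..(r + a), (m / (2 * a)) * (r + a - x) := by
    apply integral_congr
    intro x hx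
    rw [Set.uIcc_of_le hle] at hx
    simp only [cK]
    rw [min_eq_right (by linarith [hx.1])]
    ring
  rw [e1, e2, intervalIntegral.integral_const, intervalIntegral.integral_const_mul,
    intervalIntegral.integral_sub (by simp) (by simp), intervalIntegral.integral_const,
    integral_id]
  simp only [smul_eq_mul]
  rcases le_total r a with h | h
  · rw [abs_of_nonpos (by linarith), min_eq_left h]; field_simp; ring
  · rw [abs_of_nonneg (by linarith), min_eq_right h]; field_simp; ring

lemma gExp_eq (lamP m a s : ℝ) {r : ℝ} (h : 0 ≤ r + a) : gExp lamP m a s r =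
    2 * lamP * ((∫ x in (0:ℝ)..(r + a), Real.exp (cK m a r x * (s - 1))) - (r + a)) := by
  unfold gExp
  congr 2
  apply integral_congr
  intro x hx
  rw [Set.uIcc_of_le h] at hx
  simp only [cK, interLen_eq hx.2]

lemma exp_bound {m a r x s δ : ℝ} (hm : 0 < m) (ha : 0 < a) (hr : 0 < r) (hx : x ≤ r + a)
    (hs : |s - 1| ≤ δ) : Real.exp (cK m a r x * (s - 1)) ≤ Real.exp (m * δ) := by
  apply Real.exp_le_exp.2
  have h0 := cK_nonneg hm ha hr hx
  calc cK m a r x * (s - 1) ≤ cK m a r x * δ :=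
        mul_le_mul_of_nonneg_left ((le_abs_self _).trans hs) h0
    _ ≤ m * δ := mul_le_mul_of_nonneg_right (cK_le hm ha) ((abs_nonneg _).trans hs)

noncomputable def dK (m a s r : ℝ) : ℝ :=
  ∫ x in (0:ℝ)..(r + a), Real.exp (cK m a r x * (s - 1)) * cK m a r x

lemma dK_integrand_bound {m a r x s δ : ℝ} (hm : 0 < m) (ha : 0 < a) (hr : 0 < r) (hx : x ≤ r + a)
    (hs : |s - 1| ≤ δ) :
    ‖Real.exp (cK m a r x * (s - 1)) * cK m a r x‖ ≤ Real.exp (m * δ) * m := by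
  rw [Real.norm_of_nonneg (mul_nonneg (Real.exp_pos _).le (cK_nonneg hm ha hr hx))]
  exact mul_le_mul (exp_bound hm ha hr hx hs) (cK_le hm ha) (cK_nonneg hm ha hr hx)
    (Real.exp_pos _).le

lemma hasDerivAt_gExp {lamP m a r : ℝ} (hm : 0 < m) (ha : 0 < a) (hr : 0 < r) (s : ℝ) :
    HasDerivAt (fun s => gExp lamP m a s r) (2 * lamP * dK m a s r) s := by
  have hra : 0 ≤ r + a := by positivity
  simp only [gExp_eq lamP m a _ hra]
  have hc := cK_cont' m a r
  refine HasDerivAt.const_mul _ (HasDerivAt.sub_const _ ?_)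
  refine (intervalIntegral.hasDerivAt_integral_of_dominated_loc_of_deriv_le
    (F := fun s x => Real.exp (cK m a r x * (s - 1)))
    (F' := fun s x => Real.exp (cK m a r x * (s - 1)) * cK m a r x)
    (bound := fun _ => Real.exp (m * (|s - 1| + 1)) * m)
    (Metric.ball_mem_nhds s one_pos) ?_ ?_ ?_ ?_ ?_ ?_).2
  · refine Filter.Eventually.of_forall fun u => ?_
    exact Continuous.aestronglyMeasurable (by fun_prop)
  · exact Continuous.intervalIntegrable (by fun_prop) _ _
  · exact Continuous.aestronglyMeasurable (by fun_prop)
  · refine Filter.Eventually.of_forall fun x hx u hu => ?_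
    rw [Set.uIoc_of_le hra] at hx
    refine dK_integrand_bound hm ha hr hx.2 ?_
    rw [Metric.mem_ball, Real.dist_eq] at hu
    have := abs_add_le (u - s) (s - 1)
    rw [show u - s + (s - 1) = u - 1 by ring] at this
    linarith
  · simp
  · refine Filter.Eventually.of_forall fun x _ u _ => ?_
    have h := (((hasDerivAt_id u).sub_const 1).const_mul (cK m a r x)).exp
    simpa using h

lemma dK_bound {m a r s δ : ℝ} (hm : 0 < m) (ha : 0 < a) (hr : 0 < r) (hs : |s - 1| ≤ δ) :
    |dK m a s r| ≤ Real.exp (m * δ) * m * (r + a) := by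
  have hra : 0 ≤ r + a := by positivity
  have := intervalIntegral.norm_integral_le_of_norm_le_const (a := 0) (b := r + a)
    (f := fun x => Real.exp (cK m a r x * (s - 1)) * cK m a r x) (C := Real.exp (m * δ) * m) ?_
  · rwa [sub_zero, abs_of_nonneg hra] at this
  · intro x hx
    rw [Set.uIoc_of_le hra] at hx
    exact dK_integrand_bound hm ha hr hx.2 hs

lemma gExp_bound {lamP m a r s δ : ℝ} (hP : 0 < lamP) (hm : 0 < m) (ha : 0 < a) (hr : 0 < r)
    (hs : |s - 1| ≤ δ) :
    gExp lamP m a s r ≤ 2 * lamP * ((Real.exp (m * δ) - 1) * (r + a)) := by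
  have hra : 0 ≤ r + a := by positivity
  rw [gExp_eq lamP m a s hra]
  have := intervalIntegral.norm_integral_le_of_norm_le_const (a := 0) (b := r + a)
    (f := fun x => Real.exp (cK m a r x * (s - 1))) (C := Real.exp (m * δ)) ?_
  · rw [sub_zero, abs_of_nonneg hra] at this
    have h2 := (le_abs_self _).trans this
    refine mul_le_mul_of_nonneg_left ?_ (by positivity)
    linarith
  · intro x hx
    rw [Set.uIoc_of_le hra] at hx
    rw [Real.norm_of_nonneg (Real.exp_pos _).le]
    exact exp_bound hm ha hr hx.2 hs

lemma gExp_one (lamP m a r : ℝ) : gExp lamP m a 1 r = 0 := by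
  simp [gExp]

lemma dK_one {m a r : ℝ} (ha : 0 < a) (hr : 0 < r) : dK m a 1 r = m * r := by
  simp [dK, integral_cK ha hr]

lemma gExp_meas {lamP m a s : ℝ} (ha : 0 < a) :
    AEStronglyMeasurable (fun t => gExp lamP m a s (t / 2)) (volume.restrict (Set.Ioi 0)) := by
  have hcont : Continuous (fun t : ℝ =>
      2 * lamP * ((∫ x in (0:ℝ)..(t / 2 + a), Real.exp (cK m a (t / 2) x * (s - 1)))
        - (t / 2 + a))) := by
    have h1 : Continuous (fun t : ℝ =>
        ∫ x in (0:ℝ)..(t / 2 + a), Real.exp (cK m a (t / 2) x * (s - 1))) := by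
      apply intervalIntegral.continuous_parametric_intervalIntegral_of_continuous
      · unfold Function.uncurry cK
        fun_prop
      · fun_prop
    fun_prop
  refine hcont.aestronglyMeasurable.congr ?_
  filter_upwards [ae_restrict_mem measurableSet_Ioi] with t ht
  have : (0:ℝ) < t := ht
  rw [gExp_eq _ _ _ _ (by positivity)]

lemma integral_pow_exp (n : ℕ) {c : ℝ} (hc : 0 < c) :
    ∫ t in Set.Ioi (0:ℝ), t ^ n * Real.exp (-(c * t)) = (1 / c) ^ (n + 1) * n.factorial := by
  have h := Real.integral_rpow_mul_exp_neg_mul_Ioi (a := (n : ℝ) + 1) (r := c) (by positivity) hc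
  rw [Real.Gamma_nat_eq_factorial] at h
  rw [← Nat.cast_add_one, Real.rpow_natCast] at h
  rw [← h]
  refine setIntegral_congr_fun measurableSet_Ioi fun t _ => ?_
  simp

lemma integrable_pow_exp (n : ℕ) {c : ℝ} (hc : 0 < c) :
    IntegrableOn (fun t : ℝ => t ^ n * Real.exp (-(c * t))) (Set.Ioi (0:ℝ)) := by
  apply Integrable.of_integral_ne_zero
  rw [integral_pow_exp n hc]
  positivity

/-- The mean load on the typical RSU under the platooned traffic scenario equals
`m λ_P / λ_r`: the PGF is differentiable at `s = 1` with derivative `m λ_P / λ_r`. -/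
theorem mean_typical_load_pts (a m lamP lamr : ℝ)
    (ha : 0 < a) (hm : 0 < m) (hlamP : 0 < lamP) (hlamr : 0 < lamr) :
    HasDerivAt (fun s => pgfTypicalPTS lamP m a lamr s) (m * lamP / lamr) 1 := by
  set δ : ℝ := min 1 (Real.log (1 + lamr / lamP) / m) with hδ
  have hq : 0 < lamr / lamP := by positivity
  have hδ0 : 0 < δ := lt_min one_pos (div_pos (Real.log_pos (by linarith)) hm)
  have hδ1 : δ ≤ 1 := min_le_left _ _
  have hexp : lamP * (Real.exp (m * δ) - 1) ≤ lamr := by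
    have h1 : m * δ ≤ Real.log (1 + lamr / lamP) := by
      have := min_le_right 1 (Real.log (1 + lamr / lamP) / m)
      rw [← hδ, le_div_iff₀ hm] at this
      linarith
    have h2 : Real.exp (m * δ) ≤ 1 + lamr / lamP :=
      (Real.exp_le_exp.2 h1).trans_eq (Real.exp_log (by positivity))
    calc lamP * (Real.exp (m * δ) - 1) ≤ lamP * (lamr / lamP) :=
          mul_le_mul_of_nonneg_left (by linarith) hlamP.le
      _ = lamr := by field_simp
  have key := (_root_.hasDerivAt_integral_of_dominated_loc_of_deriv_le
    (μ := volume.restrict (Set.Ioi (0:ℝ)))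
    (F := fun s t => Real.exp (gExp lamP m a s (t / 2)) *
      (4 * lamr ^ 2 * t * Real.exp (-2 * lamr * t)))
    (F' := fun s t => Real.exp (gExp lamP m a s (t / 2)) * (2 * lamP * dK m a s (t / 2)) *
      (4 * lamr ^ 2 * t * Real.exp (-2 * lamr * t)))
    (bound := fun t => Real.exp (2 * lamr * a) * (2 * lamP * (Real.exp (m * δ) * m)) *
      (4 * lamr ^ 2) * ((1 / 2) * (t ^ 2 * Real.exp (-(lamr * t)))
        + a * (t ^ 1 * Real.exp (-(lamr * t)))))
    (x₀ := (1:ℝ)) (Metric.ball_mem_nhds 1 hδ0) ?_ ?_ ?_ ?_ ?_ ?_).2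
  · have e : ∫ t in Set.Ioi (0:ℝ), Real.exp (gExp lamP m a 1 (t / 2)) *
        (2 * lamP * dK m a 1 (t / 2)) * (4 * lamr ^ 2 * t * Real.exp (-2 * lamr * t))
        = m * lamP / lamr := by
      calc _ = ∫ t in Set.Ioi (0:ℝ), (4 * m * lamP * lamr ^ 2) *
            (t ^ 2 * Real.exp (-((2 * lamr) * t))) := by
            refine setIntegral_congr_fun measurableSet_Ioi fun t ht => ?_
            have ht' : (0:ℝ) < t := ht
            rw [gExp_one, dK_one ha (by positivity), Real.exp_zero,
              show -(2 * lamr * t) = -2 * lamr * t by ring]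
            ring
        _ = m * lamP / lamr := by
            rw [MeasureTheory.integral_const_mul, integral_pow_exp 2 (by positivity)]
            simp [Nat.factorial]
            field_simp
            norm_num
    rw [← e]
    exact key
  · refine Filter.Eventually.of_forall fun s => ?_
    exact (Real.continuous_exp.comp_aestronglyMeasurable (gExp_meas ha)).mul
      (Continuous.aestronglyMeasurable (by fun_prop))
  · have := (integrable_pow_exp 1 (c := 2 * lamr) (by positivity)).const_mul (4 * lamr ^ 2)
    refine this.congr (Filter.Eventually.of_forall fun t => ?_)
    simp only [gExp_one, Real.exp_zero]
    rw [show -(2 * lamr * t) = -2 * lamr * t by ring]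
    ring
  · have hcont : Continuous (fun t : ℝ => (2 * lamP * (m * (t / 2))) *
      (4 * lamr ^ 2 * t * Real.exp (-2 * lamr * t))) := by fun_prop
    refine hcont.aestronglyMeasurable.congr ?_
    filter_upwards [ae_restrict_mem measurableSet_Ioi] with t ht
    have ht' : (0:ℝ) < t := ht
    rw [gExp_one, dK_one ha (by positivity), Real.exp_zero, one_mul]
  · filter_upwards [ae_restrict_mem measurableSet_Ioi] with t ht s hs
    have ht' : (0:ℝ) < t := ht
    rw [Metric.mem_ball, Real.dist_eq] at hs
    have hr : 0 < t / 2 := by positivity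
    have h1 := dK_bound hm ha hr hs.le
    have h2 : gExp lamP m a s (t / 2) ≤ 2 * lamr * a + lamr * t := by
      refine (gExp_bound hlamP hm ha hr hs.le).trans ?_
      have := mul_le_mul_of_nonneg_right hexp (by positivity : 0 ≤ 2 * (t / 2 + a))
      linarith
    have h3 : Real.exp (gExp lamP m a s (t / 2)) ≤
        Real.exp (2 * lamr * a) * Real.exp (lamr * t) := by
      rw [← Real.exp_add]; exact Real.exp_le_exp.2 h2
    have h4 : Real.exp (lamr * t) * Real.exp (-2 * lamr * t) = Real.exp (-(lamr * t)) := by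
      rw [← Real.exp_add]; ring_nf
    rw [norm_mul, norm_mul, Real.norm_of_nonneg (Real.exp_pos _).le,
      Real.norm_of_nonneg (by positivity : 0 ≤ 4 * lamr ^ 2 * t * Real.exp (-2 * lamr * t)),
      norm_mul, Real.norm_of_nonneg (by positivity : 0 ≤ 2 * lamP), Real.norm_eq_abs]
    calc _ ≤ (Real.exp (2 * lamr * a) * Real.exp (lamr * t)) *
          (2 * lamP * (Real.exp (m * δ) * m * (t / 2 + a))) *
          (4 * lamr ^ 2 * t * Real.exp (-2 * lamr * t)) := by gcongr
      _ = _ := by rw [← h4]; ring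
  · exact (((integrable_pow_exp 2 hlamr).const_mul _).add
      ((integrable_pow_exp 1 hlamr).const_mul _)).const_mul _
  · filter_upwards [ae_restrict_mem measurableSet_Ioi] with t ht s hs
    have ht' : (0:ℝ) < t := ht
    exact ((hasDerivAt_gExp hm ha (by positivity) s).exp).mul_const _
end

section
/- Let a, m, λ_r > 0 and set λ_d = m/(2a). Define μ(t) = (1 − t/(2a))·mt/(2a) + m t²/(12a²) for 0 < t < 2a and μ(t) = 2m(t/2 − a)/t + 4ma/(3t) for t ≥ 2a. Then ∫₀^∞ μ(t) f_{L_o}(t) dt = λ_d · 4λ_r³ · F(2λ_r, 3) − (λ_d/(3a)) · 4λ_r³ · F(2λ_r, 4) + 4 m λ_r³ · G(2λ_r, 2) − (8 m a/3) · λ_r³ · G(2λ_r, 1), where F(c,k) = [Γ(k+1) − Γ_u(k+1, 2ca)]/c^{k+1} and G(c,k) = Γ_u(k+1, 2ca)/c^{k+1}. -/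
open MeasureTheory Real

/-- Upper incomplete gamma function `Γ_u(a,x) = ∫_x^∞ u^{a−1} e^{−u} du`. -/
noncomputable def upperGamma (a x : ℝ) : ℝ := ∫ u in Set.Ioi x, u ^ (a - 1) * Real.exp (-u)

/-- `F(c,k) = ∫₀^{2a} x^k e^{−cx} dx = [Γ(k+1) − Γ_u(k+1, 2ca)]/c^{k+1}`. -/
noncomputable def Ffun (a c : ℝ) (k : ℕ) : ℝ :=
  (Real.Gamma ((k : ℝ) + 1) - upperGamma ((k : ℝ) + 1) (2 * c * a)) / c ^ (k + 1)

/-- `G(c,k) = ∫_{2a}^∞ x^k e^{−cx} dx = Γ_u(k+1, 2ca)/c^{k+1}`. -/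
noncomputable def Gfun (a c : ℝ) (k : ℕ) : ℝ :=
  upperGamma ((k : ℝ) + 1) (2 * c * a) / c ^ (k + 1)

/-- Conditional mean number of tagged-platoon vehicles in a serving interval of length `t`. -/
noncomputable def muV (a m t : ℝ) : ℝ :=
  if t < 2 * a then (1 - t / (2 * a)) * (m * t / (2 * a)) + m * t ^ 2 / (12 * a ^ 2)
  else 2 * m * (t / 2 - a) / t + 4 * m * a / (3 * t)

lemma integrableOn_pow_exp_aux (c : ℝ) (hc : 0 < c) (k : ℕ) :
    IntegrableOn (fun t : ℝ => t ^ k * Real.exp (-c * t)) (Set.Ioi 0) := by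
  have h := integrableOn_rpow_mul_exp_neg_mul_rpow (p := 1) (s := (k : ℝ)) (b := c)
    (by have : (0 : ℝ) ≤ k := Nat.cast_nonneg k
        linarith) zero_lt_one hc
  simpa using h

lemma integral_Ioi_pow_exp_aux (c x : ℝ) (hc : 0 < c) (k : ℕ) :
    ∫ t in Set.Ioi x, t ^ k * Real.exp (-c * t)
      = upperGamma ((k : ℝ) + 1) (c * x) / c ^ (k + 1) := by
  have h := integral_comp_mul_left_Ioi
    (fun u : ℝ => u ^ ((k : ℝ) + 1 - 1) * Real.exp (-u)) x hc
  have hne : c ≠ 0 := hc.ne'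
  simp only [add_sub_cancel_right, Real.rpow_natCast, smul_eq_mul] at h
  unfold upperGamma
  simp only [add_sub_cancel_right, Real.rpow_natCast]
  have h2 : ∫ t in Set.Ioi x, (c * t) ^ k * Real.exp (-(c * t))
      = c ^ k * ∫ t in Set.Ioi x, t ^ k * Real.exp (-c * t) := by
    rw [← integral_const_mul]
    congr 1
    funext t
    rw [mul_pow, neg_mul, mul_assoc]
  rw [h2] at h
  rw [eq_div_iff (pow_ne_zero _ hne), pow_succ]
  field_simp at h
  simp only [neg_mul]
  linarith

lemma upperGamma_zero_aux (k : ℕ) : upperGamma ((k : ℝ) + 1) 0 = Real.Gamma ((k : ℝ) + 1) := by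
  rw [Real.Gamma_eq_integral (by positivity)]
  unfold upperGamma
  congr 1
  funext u
  ring

lemma Gfun_eq_aux (a c : ℝ) (hc : 0 < c) (k : ℕ) :
    Gfun a c k = ∫ t in Set.Ioi (2 * a), t ^ k * Real.exp (-c * t) := by
  rw [integral_Ioi_pow_exp_aux c _ hc, Gfun]
  congr 2
  ring

lemma Ffun_eq_aux (a c : ℝ) (ha : 0 < a) (hc : 0 < c) (k : ℕ) :
    Ffun a c k = ∫ t in Set.Ioo 0 (2 * a), t ^ k * Real.exp (-c * t) := by
  have hi := integrableOn_pow_exp_aux c hc k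
  have h0 := integral_Ioi_pow_exp_aux c 0 hc k
  rw [mul_zero, upperGamma_zero_aux] at h0
  have hG := Gfun_eq_aux a c hc k
  have h2a : (0 : ℝ) ≤ 2 * a := by positivity
  rw [← Set.Ioc_union_Ioi_eq_Ioi h2a, setIntegral_union (Set.Ioc_disjoint_Ioi le_rfl)
    measurableSet_Ioi (hi.mono_set Set.Ioc_subset_Ioi_self)
    (hi.mono_set (Set.Ioi_subset_Ioi h2a)), ← hG, integral_Ioc_eq_integral_Ioo] at h0
  unfold Ffun
  rw [sub_div, ← h0, Gfun]
  ring

/-- Mean number of vehicles of the tagged platoon served by the tagged RSU: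
`∫₀^∞ μ(t) f_{L_o}(t) dt` in closed form, with `λ_d = m/(2a)`. -/
theorem mean_tagged_platoon_unconditional (a m lamr : ℝ)
    (ha : 0 < a) (hm : 0 < m) (hlamr : 0 < lamr) :
    ∫ t in Set.Ioi (0 : ℝ), muV a m t * (4 * lamr ^ 3 * t ^ 2 * Real.exp (-2 * lamr * t))
      = (m / (2 * a)) * (4 * lamr ^ 3) * Ffun a (2 * lamr) 3
        - ((m / (2 * a)) / (3 * a)) * (4 * lamr ^ 3) * Ffun a (2 * lamr) 4
        + 4 * m * lamr ^ 3 * Gfun a (2 * lamr) 2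
        - (8 * m * a / 3) * lamr ^ 3 * Gfun a (2 * lamr) 1 := by
  have hc : 0 < 2 * lamr := by positivity
  have h2a : (0 : ℝ) ≤ 2 * a := by positivity
  have hi := integrableOn_pow_exp_aux (2 * lamr) hc
  have hiO : ∀ k : ℕ, IntegrableOn (fun t : ℝ => t ^ k * Real.exp (-(2 * lamr) * t))
      (Set.Ioo 0 (2 * a)) := fun k => (hi k).mono_set Set.Ioo_subset_Ioi_self
  have hiI : ∀ k : ℕ, IntegrableOn (fun t : ℝ => t ^ k * Real.exp (-(2 * lamr) * t))
      (Set.Ioi (2 * a)) := fun k => (hi k).mono_set (Set.Ioi_subset_Ioi h2a)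
  have e1 : Set.EqOn
      (fun t => muV a m t * (4 * lamr ^ 3 * t ^ 2 * Real.exp (-2 * lamr * t)))
      (fun t => (m / (2 * a)) * (4 * lamr ^ 3) * (t ^ 3 * Real.exp (-(2 * lamr) * t))
        - ((m / (2 * a)) / (3 * a)) * (4 * lamr ^ 3) * (t ^ 4 * Real.exp (-(2 * lamr) * t)))
      (Set.Ioo 0 (2 * a)) := by
    intro t ht
    simp only [muV, if_pos ht.2, neg_mul]
    field_simp
    ring
  have e2 : Set.EqOn
      (fun t => muV a m t * (4 * lamr ^ 3 * t ^ 2 * Real.exp (-2 * lamr * t)))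
      (fun t => 4 * m * lamr ^ 3 * (t ^ 2 * Real.exp (-(2 * lamr) * t))
        - (8 * m * a / 3) * lamr ^ 3 * (t ^ 1 * Real.exp (-(2 * lamr) * t)))
      (Set.Ioi (2 * a)) := by
    intro t ht
    have ht' : 2 * a < t := ht
    have htp : 0 < t := by linarith
    simp only [muV, if_neg (not_lt.mpr ht'.le), neg_mul]
    field_simp
    ring
  have i1 := ((hiO 3).const_mul ((m / (2 * a)) * (4 * lamr ^ 3))).sub
    ((hiO 4).const_mul (((m / (2 * a)) / (3 * a)) * (4 * lamr ^ 3)))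
  have i2 := ((hiI 2).const_mul (4 * m * lamr ^ 3)).sub
    ((hiI 1).const_mul ((8 * m * a / 3) * lamr ^ 3))
  have j1 := (integrableOn_congr_fun e1 measurableSet_Ioo).mpr i1
  have j2 := (integrableOn_congr_fun e2 measurableSet_Ioi).mpr i2
  rw [← Set.Ioc_union_Ioi_eq_Ioi h2a, setIntegral_union (Set.Ioc_disjoint_Ioi le_rfl)
    measurableSet_Ioi ((integrableOn_Ioc_iff_integrableOn_Ioo).mpr j1) j2,
    integral_Ioc_eq_integral_Ioo, setIntegral_congr_fun measurableSet_Ioo e1,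
    setIntegral_congr_fun measurableSet_Ioi e2,
    integral_sub ((hiO 3).const_mul _) ((hiO 4).const_mul _),
    integral_sub ((hiI 2).const_mul _) ((hiI 1).const_mul _),
    integral_const_mul, integral_const_mul, integral_const_mul, integral_const_mul,
    Ffun_eq_aux a _ ha hc, Ffun_eq_aux a _ ha hc, Gfun_eq_aux a _ hc, Gfun_eq_aux a _ hc]
  ring
end
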